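/- Let a, b be natural numbers with either b > a ≥ 3 or (a,b) = (2,3), let ε > 0, and let γ_ε : [0,ε] → ℝ³, γ_ε(t) = (t^{b/a}, t, 0), with q = b/a. Then γ_ε is simultaneously C¹-rigid and not length-minimizing; that is: (i) there exists δ > 0 such that every horizontal curve η̃ : [0,ε] → ℝ³ with η̃(0) = (0,0,0), η̃(ε) = (ε^q, ε, 0), sup_{t∈[0,ε]} |η̃(t) − γ_ε(t)| < δ, and with |η̃₁'(t) − q t^{q−1}| < δ and |η̃₂'(t) − 1| < δ for a.e. t, satisfies η̃₁(t)^a = η̃₂(t)^b and η̃₃(t) = 0 for all t (i.e. η̃ is a reparameterization of γ_ε); and (ii) there exist τ > 0 and a horizontal curve η̃ : [0,τ] → ℝ³ from (0,0,0) to (ε^q, ε, 0) with L(η̃) < L(γ_ε). -/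

import Mathlib

open MeasureTheory Set

/-- A horizontal curve for the sub-Riemannian structure on `ℝ³` spanned by the orthonormal
frame `X₁ = ∂_{x₁}`, `X₂ = ∂_{x₂} + P²∂_{x₃}` with `P(x₁,x₂) = x₁^a - x₂^b`:
an absolutely continuous curve `(x,y,z) : [0,τ] → ℝ³` with a.e. derivatives `(d1, d2, d2·P²)`. -/
structure HorizontalCurve (a b : ℕ) (τ : ℝ) where
  x : ℝ → ℝ
  y : ℝ → ℝ
  z : ℝ → ℝ
  d1 : ℝ → ℝ
  d2 : ℝ → ℝ
  hd1 : IntervalIntegrable d1 volume 0 τ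
  hd2 : IntervalIntegrable d2 volume 0 τ
  hx : ∀ t ∈ Icc (0:ℝ) τ, x t = x 0 + ∫ s in (0:ℝ)..t, d1 s
  hy : ∀ t ∈ Icc (0:ℝ) τ, y t = y 0 + ∫ s in (0:ℝ)..t, d2 s
  hz : ∀ t ∈ Icc (0:ℝ) τ, z t = z 0 + ∫ s in (0:ℝ)..t, d2 s * ((x s) ^ a - (y s) ^ b) ^ 2

/-- The sub-Riemannian length of a horizontal curve, i.e. the Euclidean length of its planar
projection. -/
noncomputable def HorizontalCurve.length {a b : ℕ} {τ : ℝ} (η : HorizontalCurve a b τ) : ℝ :=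
  ∫ t in (0:ℝ)..τ, Real.sqrt (η.d1 t ^ 2 + η.d2 t ^ 2)

open Filter Topology

namespace HorizontalCurve

variable {a b : ℕ} {τ : ℝ}

theorem integrableOn_d1_Icc (η : HorizontalCurve a b τ) (hτ : 0 ≤ τ) :
    IntegrableOn η.d1 (uIcc 0 τ) := by
  rw [uIcc_of_le hτ, integrableOn_Icc_iff_integrableOn_Ioc]
  exact (intervalIntegrable_iff_integrableOn_Ioc_of_le hτ).1 η.hd1

theorem integrableOn_d2_Icc (η : HorizontalCurve a b τ) (hτ : 0 ≤ τ) :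
    IntegrableOn η.d2 (uIcc 0 τ) := by
  rw [uIcc_of_le hτ, integrableOn_Icc_iff_integrableOn_Ioc]
  exact (intervalIntegrable_iff_integrableOn_Ioc_of_le hτ).1 η.hd2

theorem continuousOn_x (η : HorizontalCurve a b τ) (hτ : 0 ≤ τ) :
    ContinuousOn η.x (Icc 0 τ) := by
  have h := intervalIntegral.continuousOn_primitive_interval (η.integrableOn_d1_Icc hτ)
  rw [uIcc_of_le hτ] at h
  exact (continuousOn_const.add h).congr η.hx

theorem continuousOn_y (η : HorizontalCurve a b τ) (hτ : 0 ≤ τ) :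
    ContinuousOn η.y (Icc 0 τ) := by
  have h := intervalIntegral.continuousOn_primitive_interval (η.integrableOn_d2_Icc hτ)
  rw [uIcc_of_le hτ] at h
  exact (continuousOn_const.add h).congr η.hy

theorem continuousOn_sq (η : HorizontalCurve a b τ) (hτ : 0 ≤ τ) :
    ContinuousOn (fun s => ((η.x s) ^ a - (η.y s) ^ b) ^ 2) (Icc 0 τ) :=
  (((η.continuousOn_x hτ).pow a).sub ((η.continuousOn_y hτ).pow b)).pow 2

theorem intervalIntegrable_dz (η : HorizontalCurve a b τ) (hτ : 0 ≤ τ) :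
    IntervalIntegrable (fun s => η.d2 s * ((η.x s) ^ a - (η.y s) ^ b) ^ 2) volume 0 τ :=
  η.hd2.mul_continuousOn (by rw [uIcc_of_le hτ]; exact η.continuousOn_sq hτ)

theorem intervalIntegrable_speed (η : HorizontalCurve a b τ) :
    IntervalIntegrable (fun s => Real.sqrt (η.d1 s ^ 2 + η.d2 s ^ 2)) volume 0 τ := by
  refine (η.hd1.abs.add η.hd2.abs).mono_fun ?_ (Eventually.of_forall fun s => ?_)
  · exact Real.continuous_sqrt.comp_aestronglyMeasurable
      ((η.hd1.def'.aestronglyMeasurable.pow 2).add (η.hd2.def'.aestronglyMeasurable.pow 2))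
  · have h : 0 ≤ |η.d1 s| + |η.d2 s| := by positivity
    simp only [Real.norm_eq_abs]
    rw [abs_of_nonneg (Real.sqrt_nonneg _), abs_of_nonneg h]
    refine Real.sqrt_le_iff.2 ⟨h, ?_⟩
    nlinarith [sq_abs (η.d1 s), sq_abs (η.d2 s), abs_nonneg (η.d1 s), abs_nonneg (η.d2 s),
      mul_nonneg (abs_nonneg (η.d1 s)) (abs_nonneg (η.d2 s))]

/-- A closed-up third coordinate along a curve with increasing `y` forces the curve to stay in
the zero set of `P`. -/
theorem eq_zero_of_d2_pos (η : HorizontalCurve a b τ) (hτ : 0 < τ)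
    (hd : ∀ᵐ t ∂volume, t ∈ Icc (0:ℝ) τ → 0 < η.d2 t) (h0 : η.z 0 = 0) (h1 : η.z τ = 0) :
    ∀ t ∈ Icc (0:ℝ) τ, (η.x t) ^ a = (η.y t) ^ b ∧ η.z t = 0 := by
  set f : ℝ → ℝ := fun s => η.d2 s * ((η.x s) ^ a - (η.y s) ^ b) ^ 2 with hf
  have hnn : 0 ≤ᵐ[volume.restrict (Ioc 0 τ)] f := by
    filter_upwards [ae_restrict_of_ae hd, ae_restrict_mem measurableSet_Ioc] with t ht hm
    exact mul_nonneg (ht (Ioc_subset_Icc_self hm)).le (sq_nonneg _)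
  have hint : ∫ s in (0:ℝ)..τ, f s = 0 := by
    have := η.hz τ ⟨hτ.le, le_rfl⟩
    linarith
  have hae : f =ᵐ[volume.restrict (Ioc 0 τ)] 0 :=
    (intervalIntegral.integral_eq_zero_iff_of_le_of_nonneg_ae hτ.le hnn
      (η.intervalIntegrable_dz hτ.le)).1 hint
  have hP : (fun s => ((η.x s) ^ a - (η.y s) ^ b) ^ 2) =ᵐ[volume.restrict (Icc 0 τ)]
      fun _ => (0:ℝ) := by
    rw [← restrict_Ioc_eq_restrict_Icc]
    filter_upwards [hae, ae_restrict_of_ae hd, ae_restrict_mem measurableSet_Ioc] with t h1 h2 hm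
    exact (mul_eq_zero.1 h1).resolve_left (h2 (Ioc_subset_Icc_self hm)).ne'
  have hP' := Measure.eqOn_Icc_of_ae_eq volume hτ.ne hP (η.continuousOn_sq hτ.le)
    continuousOn_const
  intro t ht
  refine ⟨sub_eq_zero.1 (pow_eq_zero_iff two_ne_zero |>.1 (hP' ht)), ?_⟩
  rw [η.hz t ht, h0, zero_add]
  refine (intervalIntegral.integral_congr (g := fun _ => 0) fun s hs => ?_).trans (by simp)
  rw [uIcc_of_le ht.1] at hs
  exact mul_eq_zero_of_right _ (hP' ⟨hs.1, hs.2.trans ht.2⟩)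

end HorizontalCurve

section Glue

variable {f g : ℝ → ℝ} {σ τ : ℝ}

/-- The function equal to `f` up to time `σ` and to the time-shifted `g` afterwards. -/
noncomputable def glue (σ : ℝ) (f g : ℝ → ℝ) (t : ℝ) : ℝ := if t ≤ σ then f t else g (t - σ)

theorem glue_of_le {t : ℝ} (h : t ≤ σ) : glue σ f g t = f t := if_pos h

theorem glue_of_ge {t : ℝ} (h : σ ≤ t) (hfg : g 0 = f σ) : glue σ f g t = g (t - σ) := by
  rcases h.eq_or_lt with rfl | h
  · simp [glue, hfg]
  · exact if_neg h.not_ge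

theorem intervalIntegrable_glue_left (hσ : 0 ≤ σ) (hf : IntervalIntegrable f volume 0 σ) :
    IntervalIntegrable (glue σ f g) volume 0 σ :=
  hf.congr fun t ht => by
    rw [uIoc_of_le hσ] at ht
    exact (glue_of_le ht.2).symm

theorem intervalIntegrable_glue_right (hτ : 0 ≤ τ) (hg : IntervalIntegrable g volume 0 τ) :
    IntervalIntegrable (glue σ f g) volume σ (σ + τ) := by
  have h := hg.comp_sub_right σ
  rw [zero_add, add_comm τ σ] at h
  refine h.congr fun t ht => ?_
  rw [uIoc_of_le (by linarith)] at ht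
  exact (if_neg ht.1.not_ge).symm

theorem intervalIntegrable_glue (hσ : 0 ≤ σ) (hτ : 0 ≤ τ) (hf : IntervalIntegrable f volume 0 σ)
    (hg : IntervalIntegrable g volume 0 τ) :
    IntervalIntegrable (glue σ f g) volume 0 (σ + τ) :=
  (intervalIntegrable_glue_left hσ hf).trans (intervalIntegrable_glue_right hτ hg)

theorem integral_glue_of_le {t : ℝ} (ht : 0 ≤ t) (htσ : t ≤ σ) :
    ∫ s in (0:ℝ)..t, glue σ f g s = ∫ s in (0:ℝ)..t, f s :=
  intervalIntegral.integral_congr fun s hs => by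
    rw [uIcc_of_le ht] at hs
    exact glue_of_le (hs.2.trans htσ)

theorem integral_glue_of_ge (hσ : 0 ≤ σ) (hf : IntervalIntegrable f volume 0 σ)
    (hg : IntervalIntegrable g volume 0 τ) {t : ℝ} (ht : σ ≤ t) (htτ : t ≤ σ + τ) :
    ∫ s in (0:ℝ)..t, glue σ f g s =
      (∫ s in (0:ℝ)..σ, f s) + ∫ s in (0:ℝ)..(t - σ), g s := by
  have hg' : IntervalIntegrable g volume 0 (t - σ) := by
    refine hg.mono_set ?_
    rw [uIcc_of_le (by linarith), uIcc_of_le (by linarith)]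
    exact Icc_subset_Icc_right (by linarith)
  have h2 := intervalIntegrable_glue_right (σ := σ) (f := f) (sub_nonneg.2 ht) hg'
  rw [add_sub_cancel] at h2
  rw [← intervalIntegral.integral_add_adjacent_intervals
    (intervalIntegrable_glue_left hσ hf) h2, integral_glue_of_le hσ le_rfl]
  congr 1
  have h3 : ∫ s in σ..t, glue σ f g s = ∫ s in σ..t, g (s - σ) := by
    refine intervalIntegral.integral_congr_ae (Eventually.of_forall fun s hs => ?_)
    rw [uIoc_of_le ht] at hs
    exact if_neg hs.1.not_ge
  rw [h3, intervalIntegral.integral_comp_sub_right, sub_self]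

/-- The glued function is a primitive of the glued derivative. -/
theorem glue_eq_integral {F G : ℝ → ℝ} (hσ : 0 ≤ σ)
    (hf : IntervalIntegrable f volume 0 σ) (hg : IntervalIntegrable g volume 0 τ)
    (hF : ∀ t ∈ Icc 0 σ, F t = F 0 + ∫ s in (0:ℝ)..t, f s)
    (hG : ∀ t ∈ Icc 0 τ, G t = G 0 + ∫ s in (0:ℝ)..t, g s) (hFG : G 0 = F σ) :
    ∀ t ∈ Icc 0 (σ + τ), glue σ F G t = glue σ F G 0 + ∫ s in (0:ℝ)..t, glue σ f g s := by
  intro t ht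
  rw [glue_of_le hσ]
  rcases le_total t σ with h | h
  · rw [glue_of_le h, integral_glue_of_le ht.1 h, hF t ⟨ht.1, h⟩]
  · rw [glue_of_ge h hFG, integral_glue_of_ge hσ hf hg h ht.2,
      hG _ ⟨by linarith, by linarith [ht.2]⟩, hFG, hF σ ⟨hσ, le_rfl⟩, add_assoc]

end Glue

/-- Concatenation of horizontal curves. -/
noncomputable def HorizontalCurve.trans {a b : ℕ} {σ τ : ℝ} (η : HorizontalCurve a b σ)
    (θ : HorizontalCurve a b τ) (hσ : 0 ≤ σ) (hτ : 0 ≤ τ) (hx : θ.x 0 = η.x σ)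
    (hy : θ.y 0 = η.y σ) (hz : θ.z 0 = η.z σ) : HorizontalCurve a b (σ + τ) where
  x := glue σ η.x θ.x
  y := glue σ η.y θ.y
  z := glue σ η.z θ.z
  d1 := glue σ η.d1 θ.d1
  d2 := glue σ η.d2 θ.d2
  hd1 := intervalIntegrable_glue hσ hτ η.hd1 θ.hd1
  hd2 := intervalIntegrable_glue hσ hτ η.hd2 θ.hd2
  hx := glue_eq_integral hσ η.hd1 θ.hd1 η.hx θ.hx hx
  hy := glue_eq_integral hσ η.hd2 θ.hd2 η.hy θ.hy hy
  hz := by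
    have h := glue_eq_integral hσ (η.intervalIntegrable_dz hσ) (θ.intervalIntegrable_dz hτ)
      η.hz θ.hz hz
    have e : ∀ s, glue σ η.d2 θ.d2 s * (glue σ η.x θ.x s ^ a - glue σ η.y θ.y s ^ b) ^ 2 =
        glue σ (fun s => η.d2 s * (η.x s ^ a - η.y s ^ b) ^ 2)
          (fun s => θ.d2 s * (θ.x s ^ a - θ.y s ^ b) ^ 2) s := fun s => by
      simp only [glue]
      split_ifs <;> rfl
    simpa only [e] using h

/-- `p` and `q` are joined by a horizontal curve of length `ℓ`. -/
def HorizontallyJoined (a b : ℕ) (p q : ℝ × ℝ × ℝ) (ℓ : ℝ) : Prop :=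
  ∃ τ : ℝ, 0 ≤ τ ∧ ∃ η : HorizontalCurve a b τ, (η.x 0, η.y 0, η.z 0) = p ∧
    (η.x τ, η.y τ, η.z τ) = q ∧ η.length = ℓ

namespace HorizontallyJoined

variable {a b : ℕ}

theorem trans {p q r : ℝ × ℝ × ℝ} {ℓ m : ℝ} (h₁ : HorizontallyJoined a b p q ℓ)
    (h₂ : HorizontallyJoined a b q r m) : HorizontallyJoined a b p r (ℓ + m) := by
  obtain ⟨σ, hσ, η, rfl, rfl, rfl⟩ := h₁
  obtain ⟨τ, hτ, θ, hθ, rfl, rfl⟩ := h₂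
  simp only [Prod.mk.injEq] at hθ
  obtain ⟨hx, hy, hz⟩ := hθ
  refine ⟨σ + τ, add_nonneg hσ hτ, η.trans θ hσ hτ hx hy hz, ?_, ?_, ?_⟩
  · simp only [HorizontalCurve.trans, glue_of_le hσ]
  · have h : σ ≤ σ + τ := by linarith
    simp only [HorizontalCurve.trans, glue_of_ge h hx, glue_of_ge h hy, glue_of_ge h hz,
      add_sub_cancel_left]
  · have h := integral_glue_of_ge hσ η.intervalIntegrable_speed θ.intervalIntegrable_speed
      (t := σ + τ) (by linarith) le_rfl
    rw [add_sub_cancel_left] at h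
    rw [HorizontalCurve.length, HorizontalCurve.length, HorizontalCurve.length, ← h]
    congr 1 with s
    simp only [HorizontalCurve.trans, glue]
    split_ifs <;> rfl

/-- The horizontal lift of a continuously differentiable planar curve. -/
theorem of_hasDerivAt {X Y u v : ℝ → ℝ} {τ : ℝ} (hτ : 0 ≤ τ) (hX : ∀ t, HasDerivAt X (u t) t)
    (hY : ∀ t, HasDerivAt Y (v t) t) (hu : Continuous u) (hv : Continuous v) (z : ℝ) :
    HorizontallyJoined a b (X 0, Y 0, z)
      (X τ, Y τ, z + ∫ s in (0:ℝ)..τ, v s * (X s ^ a - Y s ^ b) ^ 2)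
      (∫ s in (0:ℝ)..τ, Real.sqrt (u s ^ 2 + v s ^ 2)) :=
  ⟨τ, hτ,
    { x := X
      y := Y
      z := fun t => z + ∫ s in (0:ℝ)..t, v s * (X s ^ a - Y s ^ b) ^ 2
      d1 := u
      d2 := v
      hd1 := hu.intervalIntegrable _ _
      hd2 := hv.intervalIntegrable _ _
      hx := fun t _ => by
        rw [intervalIntegral.integral_eq_sub_of_hasDerivAt (fun s _ => hX s)
          (hu.intervalIntegrable _ _)]
        ring
      hy := fun t _ => by
        rw [intervalIntegral.integral_eq_sub_of_hasDerivAt (fun s _ => hY s)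
          (hv.intervalIntegrable _ _)]
        ring
      hz := fun t _ => by simp },
    by simp, rfl, rfl⟩

/-- The horizontal lift of a planar segment. -/
theorem segment {τ : ℝ} (hτ : 0 ≤ τ) (x y u v z : ℝ) :
    HorizontallyJoined a b (x, y, z)
      (x + τ * u, y + τ * v,
        z + ∫ s in (0:ℝ)..τ, v * ((x + s * u) ^ a - (y + s * v) ^ b) ^ 2)
      (τ * Real.sqrt (u ^ 2 + v ^ 2)) := by
  have h := of_hasDerivAt (a := a) (b := b) (X := fun s => x + s * u) (Y := fun s => y + s * v)
    (u := fun _ => u) (v := fun _ => v) hτ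
    (fun t => by simpa using ((hasDerivAt_id t).mul_const u).const_add x)
    (fun t => by simpa using ((hasDerivAt_id t).mul_const v).const_add y)
    continuous_const continuous_const z
  simpa using h

/-- The rectangular loop with sides `r` and `h`, based at its upper left corner. -/
theorem rectangle {r h : ℝ} (hr : 0 ≤ r) (hh : 0 ≤ h) (x y z : ℝ) :
    HorizontallyJoined a b (x, y, z)
      (x, y, z - ∫ s in (0:ℝ)..h,
        (((x + r) ^ a - (y - s) ^ b) ^ 2 - (x ^ a - (y - s) ^ b) ^ 2))
      (2 * r + 2 * h) := by
  have h1 := segment (a := a) (b := b) hr x y 1 0 z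
  have h2 := segment (a := a) (b := b) hh (x + r) y 0 (-1) z
  set z₂ := z + ∫ s in (0:ℝ)..h, (-1) * ((x + r + s * 0) ^ a - (y + s * (-1)) ^ b) ^ 2 with hz₂
  have h3 := segment (a := a) (b := b) hr (x + r) (y - h) (-1) 0 z₂
  have h4 := segment (a := a) (b := b) hh x (y - h) 0 1 z₂
  have hz : z₂ + ∫ s in (0:ℝ)..h, 1 * ((x + s * 0) ^ a - (y - h + s * 1) ^ b) ^ 2 =
      z - ∫ s in (0:ℝ)..h,
        (((x + r) ^ a - (y - s) ^ b) ^ 2 - (x ^ a - (y - s) ^ b) ^ 2) := by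
    rw [intervalIntegral.integral_sub (Continuous.intervalIntegrable (by fun_prop) _ _)
      (Continuous.intervalIntegrable (by fun_prop) _ _), hz₂,
      intervalIntegral.integral_const_mul]
    have hflip := intervalIntegral.integral_comp_sub_left (a := 0) (b := h)
      (fun s => (x ^ a - (y - s) ^ b) ^ 2) h
    simp only [sub_self, sub_zero] at hflip
    rw [← hflip]
    have e : ∀ s : ℝ, y - (h - s) = y - h + s := fun s => by ring
    simp only [mul_zero, add_zero, mul_one, one_mul, e, mul_neg, ← sub_eq_add_neg]
    ring
  rw [hz] at h4
  simp only [mul_one, mul_zero, add_zero, zero_mul, intervalIntegral.integral_zero, mul_neg,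
    ← sub_eq_add_neg, add_sub_cancel_right, sub_add_cancel] at h1 h2 h3 h4
  norm_num at h1 h2 h3 h4
  have h5 := ((h1.trans h2).trans h3).trans h4
  rwa [show r + h + r + h = 2 * r + 2 * h by ring] at h5

/-- The horizontal lift of an arc of the curve `x = y ^ (b / a)`. -/
theorem arc {q : ℝ} (hq : q * a = b) (hq1 : 1 ≤ q) {t ε : ℝ} (ht : 0 ≤ t)
    (htε : t ≤ ε) (z : ℝ) :
    HorizontallyJoined a b (t ^ q, t, z) (ε ^ q, ε, z)
      (∫ s in t..ε, Real.sqrt (1 + q ^ 2 * s ^ (2 * q - 2))) := by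
  have h := of_hasDerivAt (a := a) (b := b) (X := fun s => (t + s) ^ q) (Y := fun s => t + s)
    (u := fun s => q * (t + s) ^ (q - 1)) (v := fun _ => 1) (τ := ε - t) (by linarith)
    (fun s => by
      simpa using ((hasDerivAt_id s).const_add t).rpow_const (p := q) (Or.inr hq1))
    (fun s => by simpa using (hasDerivAt_id s).const_add t)
    (continuous_const.mul ((continuous_const.add continuous_id).rpow_const
      fun _ => Or.inr (by simpa using hq1)))
    continuous_const z
  have hz : ∫ s in (0:ℝ)..(ε - t), (1:ℝ) * (((t + s) ^ q) ^ a - (t + s) ^ b) ^ 2 = 0 := by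
    refine (intervalIntegral.integral_congr (g := fun _ => 0) fun s hs => ?_).trans (by simp)
    rw [uIcc_of_le (by linarith)] at hs
    have h0 : 0 ≤ t + s := by linarith [hs.1]
    have : ((t + s) ^ q) ^ a = (t + s) ^ b := by
      rw [← Real.rpow_natCast, ← Real.rpow_mul h0, hq, Real.rpow_natCast]
    simp [this]
  have hl : ∫ s in (0:ℝ)..(ε - t), Real.sqrt ((q * (t + s) ^ (q - 1)) ^ 2 + 1 ^ 2) =
      ∫ s in t..ε, Real.sqrt (1 + q ^ 2 * s ^ (2 * q - 2)) := by
    rw [intervalIntegral.integral_comp_add_left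
      (fun s => Real.sqrt ((q * s ^ (q - 1)) ^ 2 + 1 ^ 2)) t]
    simp only [add_zero, add_sub_cancel]
    refine intervalIntegral.integral_congr fun s hs => ?_
    rw [uIcc_of_le htε] at hs
    have h0 : 0 ≤ s := ht.trans hs.1
    have : s ^ (2 * q - 2) = (s ^ (q - 1)) ^ 2 := by
      rw [← Real.rpow_natCast, ← Real.rpow_mul h0]
      congr 1
      push_cast
      ring
    simp only [this]
    congr 1
    ring
  simpa only [hz, hl, add_zero, add_sub_cancel] using h

end HorizontallyJoined

theorem tendsto_rpow_nhdsGT_zero {p : ℝ} (hp : 0 < p) :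
    Tendsto (fun t : ℝ => t ^ p) (𝓝[>] 0) (𝓝 0) := by
  have h := (Real.continuousAt_rpow_const 0 p (Or.inr hp.le)).tendsto
  rw [Real.zero_rpow hp.ne'] at h
  exact h.mono_left nhdsWithin_le_nhds

/-- The length saved by replacing an initial arc of `x = y ^ q` by its chord. -/
theorem eventually_chord_add_le_arc {q : ℝ} (hq : 1 < q) :
    ∀ᶠ t : ℝ in 𝓝[>] 0,
      t * Real.sqrt ((t ^ (q - 1)) ^ 2 + 1) + (q - 1) ^ 2 / (4 * (2 * q - 1)) * t ^ (2 * q - 1) ≤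
        ∫ s in (0:ℝ)..t, Real.sqrt (1 + q ^ 2 * s ^ (2 * q - 2)) := by
  set κ : ℝ := (2 * q - 1 + q ^ 2) / (2 * q ^ 2) with hκ
  have hκ0 : 0 < κ := by apply div_pos <;> nlinarith
  have hκ1 : κ < 1 := by
    rw [hκ, div_lt_one (by positivity)]
    nlinarith [sq_pos_of_pos (sub_pos.2 hq)]
  have hsmall : ∀ᶠ t : ℝ in 𝓝[>] 0, κ ^ 2 * (q ^ 2 * t ^ (2 * q - 2)) / 4 < 1 - κ := by
    have h := (((tendsto_rpow_nhdsGT_zero (p := 2 * q - 2) (by linarith)).const_mul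
      (q ^ 2)).const_mul (κ ^ 2)).div_const 4
    simp only [mul_zero, zero_div] at h
    exact h.eventually (gt_mem_nhds (by linarith))
  filter_upwards [hsmall, self_mem_nhdsWithin] with t ht ht0
  have ht0 : 0 < t := ht0
  have hcont : Continuous fun s : ℝ => s ^ (2 * q - 2) :=
    continuous_id.rpow_const fun _ => Or.inr (by linarith)
  have hsqrt : ∀ s ∈ Icc 0 t,
      1 + κ * q ^ 2 / 2 * s ^ (2 * q - 2) ≤ Real.sqrt (1 + q ^ 2 * s ^ (2 * q - 2)) := by
    intro s hs
    have hs0 : 0 ≤ s ^ (2 * q - 2) := Real.rpow_nonneg hs.1 _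
    have hst : s ^ (2 * q - 2) ≤ t ^ (2 * q - 2) :=
      Real.rpow_le_rpow hs.1 hs.2 (by linarith)
    apply Real.le_sqrt_of_sq_le
    set w := q ^ 2 * s ^ (2 * q - 2) with hw
    have hw0 : 0 ≤ w := by positivity
    have hw1 : κ ^ 2 * w / 4 ≤ 1 - κ := by
      refine le_trans ?_ ht.le
      have : w ≤ q ^ 2 * t ^ (2 * q - 2) := mul_le_mul_of_nonneg_left hst (sq_nonneg q)
      gcongr
    have : (1 + κ * q ^ 2 / 2 * s ^ (2 * q - 2)) = 1 + κ * w / 2 := by rw [hw]; ring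
    rw [this]
    nlinarith [mul_le_mul_of_nonneg_left hw1 hw0]
  have hle := intervalIntegral.integral_mono_on (μ := volume) ht0.le
    (Continuous.intervalIntegrable (by fun_prop) _ _)
    (Continuous.intervalIntegrable (by fun_prop) _ _) hsqrt
  refine le_trans ?_ hle
  rw [intervalIntegral.integral_add (μ := volume) (continuous_const.intervalIntegrable _ _)
    (Continuous.intervalIntegrable (by fun_prop) _ _), intervalIntegral.integral_const_mul,
    integral_rpow (Or.inl (by linarith)), Real.zero_rpow (by linarith)]
  have e1 : 2 * q - 2 + 1 = 2 * q - 1 := by ring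
  have hchord : t * Real.sqrt ((t ^ (q - 1)) ^ 2 + 1) ≤ t + t ^ (2 * q - 1) / 2 := by
    have e2 : t ^ (2 * q - 1) = t * (t ^ (q - 1)) ^ 2 := by
      rw [← Real.rpow_natCast, ← Real.rpow_mul ht0.le, ← Real.rpow_one_add' ht0.le]
      · congr 1
        push_cast
        ring
      · push_cast
        linarith
    have : Real.sqrt ((t ^ (q - 1)) ^ 2 + 1) ≤ 1 + (t ^ (q - 1)) ^ 2 / 2 := by
      refine Real.sqrt_le_iff.2 ⟨by positivity, ?_⟩
      nlinarith [sq_nonneg ((t ^ (q - 1)) ^ 2)]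
    rw [e2]
    nlinarith
  rw [e1]
  simp only [intervalIntegral.integral_const, sub_zero, smul_eq_mul, mul_one]
  have hq21 : 0 < 2 * q - 1 := by linarith
  have hid : κ * q ^ 2 / 2 * (t ^ (2 * q - 1) / (2 * q - 1)) =
      t ^ (2 * q - 1) / 2 + (q - 1) ^ 2 / (4 * (2 * q - 1)) * t ^ (2 * q - 1) := by
    rw [hκ]
    field_simp
    ring
  linarith

/-- A thin rectangle based at a point of the zero set of `P` absorbs any small defect `E` of the
third coordinate. -/
theorem exists_rectangle_height {a b : ℕ} (ha : 1 ≤ a) {p ε r E : ℝ} (hp : 0 < p)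
    (hpε : p ^ a = ε ^ b) (hr : 0 ≤ r) (hrε : r ≤ ε) (hE : 0 ≤ E)
    (hEr : E ≤ (p ^ (a - 1)) ^ 2 * r ^ 3) :
    ∃ h ∈ Icc 0 r, ∫ s in (0:ℝ)..h,
      (((p + r) ^ a - (ε - s) ^ b) ^ 2 - (p ^ a - (ε - s) ^ b) ^ 2) = E := by
  set G : ℝ → ℝ := fun s => ((p + r) ^ a - (ε - s) ^ b) ^ 2 - (p ^ a - (ε - s) ^ b) ^ 2 with hG
  have hGc : Continuous G := by fun_prop
  have hA : p ^ (a - 1) * r ≤ (p + r) ^ a - p ^ a := by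
    obtain ⟨n, rfl⟩ := Nat.exists_eq_add_of_le' ha
    have : p ^ n ≤ (p + r) ^ n := pow_le_pow_left₀ hp.le (by linarith) n
    rw [Nat.add_sub_cancel, pow_succ, pow_succ]
    nlinarith
  have hk : 0 ≤ p ^ (a - 1) * r := by positivity
  have hlow : ∀ s ∈ Icc 0 r, (p ^ (a - 1) * r) ^ 2 ≤ G s := by
    intro s hs
    have hP : 0 ≤ p ^ a - (ε - s) ^ b := by
      rw [hpε, sub_nonneg]
      exact pow_le_pow_left₀ (by linarith [hs.2]) (by linarith [hs.1]) b
    simp only [hG]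
    nlinarith [mul_nonneg (hk.trans hA) hP, pow_le_pow_left₀ hk hA 2]
  have hint := intervalIntegral.integral_mono_on (μ := volume) hr
    (continuous_const.intervalIntegrable _ _) (hGc.intervalIntegrable _ _) hlow
  rw [intervalIntegral.integral_const, sub_zero, smul_eq_mul] at hint
  have hcont : Continuous fun h => ∫ s in (0:ℝ)..h, G s :=
    intervalIntegral.continuous_primitive (fun _ _ => hGc.intervalIntegrable _ _) 0
  have := intermediate_value_Icc hr hcont.continuousOn
  exact this ⟨by simpa using hE, by nlinarith⟩

/-- Cutting the corner at the origin by a chord and correcting the third coordinate with a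
rectangle at the far endpoint gives a curve shorter than `γ_ε`. -/
theorem exists_shorter_horizontallyJoined {a b : ℕ} (ha : 1 ≤ a) {q : ℝ} (hq : q * a = b)
    (hq1 : 1 < q) (hab : 6 * q < 2 * b + 4) {ε : ℝ} (hε : 0 < ε) :
    ∃ ℓ, HorizontallyJoined a b (0, 0, 0) (ε ^ q, ε, 0) ℓ ∧
      ℓ < ∫ s in (0:ℝ)..ε, Real.sqrt (1 + q ^ 2 * s ^ (2 * q - 2)) := by
  set c : ℝ := (q - 1) ^ 2 / (4 * (2 * q - 1)) with hc
  have hc0 : 0 < c := by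
    have : 0 < q - 1 := by linarith
    have : 0 < 2 * q - 1 := by linarith
    positivity
  set k : ℝ := (ε ^ q) ^ (a - 1) with hk
  have hp : 0 < ε ^ q := Real.rpow_pos_of_pos hε q
  have hk0 : 0 < k := by positivity
  have hrpow : ∀ t : ℝ, 0 ≤ t → (t ^ q) ^ a = t ^ b := fun t ht => by
    rw [← Real.rpow_natCast, ← Real.rpow_mul ht, hq, Real.rpow_natCast]
  have ev1 : ∀ᶠ t : ℝ in 𝓝[>] 0, c / 5 * t ^ (2 * q - 1) < ε := by
    have h := (tendsto_rpow_nhdsGT_zero (p := 2 * q - 1) (by linarith)).const_mul (c / 5)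
    rw [mul_zero] at h
    exact h.eventually (gt_mem_nhds hε)
  have ev2 : ∀ᶠ t : ℝ in 𝓝[>] 0, t ^ (2 * b + 4 - 6 * q) < k ^ 2 * (c / 5) ^ 3 :=
    (tendsto_rpow_nhdsGT_zero (by linarith)).eventually (gt_mem_nhds (by positivity))
  have ev3 : ∀ᶠ t : ℝ in 𝓝[>] 0, t < ε := nhdsWithin_le_nhds (gt_mem_nhds hε)
  obtain ⟨t, h1, h2, h3, hgain, ht⟩ :=
    (ev1.and (ev2.and (ev3.and ((eventually_chord_add_le_arc hq1).and self_mem_nhdsWithin)))).exists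
  have ht : 0 < t := ht
  set r : ℝ := c / 5 * t ^ (2 * q - 1) with hr
  have ht' : 0 < t ^ (2 * q - 1) := Real.rpow_pos_of_pos ht _
  have hr0 : 0 < r := by positivity
  set m : ℝ := t ^ (q - 1) with hm
  have hm0 : 0 < m := Real.rpow_pos_of_pos ht _
  have htm : t * m = t ^ q := by
    rw [hm, ← Real.rpow_one_add' ht.le (by linarith)]
    congr 1
    ring
  set E : ℝ := ∫ s in (0:ℝ)..t, 1 * ((0 + s * m) ^ a - (0 + s * 1) ^ b) ^ 2 with hEdef
  have hE0 : 0 ≤ E := intervalIntegral.integral_nonneg ht.le fun s _ => by positivity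
  have hE1 : E ≤ t ^ (2 * b + 1) := by
    have hle : ∀ s ∈ Icc 0 t, 1 * ((0 + s * m) ^ a - (0 + s * 1) ^ b) ^ 2 ≤ (t ^ b) ^ 2 := by
      intro s hs
      have hs0 := hs.1
      have u1 : (s * m) ^ a ≤ t ^ b := by
        rw [← hrpow t ht.le, ← htm]
        have := hs.2
        gcongr
      have u2 : s ^ b ≤ t ^ b := pow_le_pow_left₀ hs.1 hs.2 b
      have l1 : 0 ≤ (s * m) ^ a := by positivity
      have l2 : 0 ≤ s ^ b := by positivity
      simp only [zero_add, mul_one, one_mul]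
      exact sq_le_sq.2 (by
        rw [abs_of_nonneg (l2.trans u2)]
        exact abs_le.2 ⟨by linarith, by linarith⟩)
    have h := intervalIntegral.integral_mono_on (μ := volume) ht.le
      (Continuous.intervalIntegrable (by fun_prop) _ _)
      (continuous_const.intervalIntegrable _ _) hle
    rw [intervalIntegral.integral_const, sub_zero, smul_eq_mul] at h
    exact h.trans_eq (by ring)
  have hE2 : E ≤ k ^ 2 * r ^ 3 := by
    refine hE1.trans ?_
    have e1 : t ^ (2 * b + 1) = t ^ (2 * b + 4 - 6 * q) * (t ^ (2 * q - 1)) ^ 3 := by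
      rw [← Real.rpow_natCast, ← Real.rpow_natCast, ← Real.rpow_mul ht.le, ← Real.rpow_add ht]
      congr 1
      push_cast
      ring
    have e2 : k ^ 2 * r ^ 3 = k ^ 2 * (c / 5) ^ 3 * (t ^ (2 * q - 1)) ^ 3 := by rw [hr]; ring
    rw [e1, e2]
    gcongr
  obtain ⟨h, hh, hhE⟩ :=
    exists_rectangle_height ha hp (hrpow ε hε.le) hr0.le h1.le hE0 hE2
  have j1 := HorizontallyJoined.segment (a := a) (b := b) ht.le 0 0 m 1 0
  rw [← hEdef] at j1
  have j2 := HorizontallyJoined.arc hq hq1.le ht.le h3.le E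
  have j3 := HorizontallyJoined.rectangle (a := a) (b := b) hr0.le hh.1 (ε ^ q) ε E
  rw [hhE, sub_self] at j3
  simp only [zero_add, mul_one, htm, one_pow] at j1
  refine ⟨_, (j1.trans j2).trans j3, ?_⟩
  have hcont : Continuous fun s : ℝ => s ^ (2 * q - 2) :=
    continuous_id.rpow_const fun _ => Or.inr (by linarith)
  rw [← intervalIntegral.integral_add_adjacent_intervals (a := 0) (b := t) (c := ε)
    (f := fun s => Real.sqrt (1 + q ^ 2 * s ^ (2 * q - 2)))
    (Continuous.intervalIntegrable (by fun_prop) _ _)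
    (Continuous.intervalIntegrable (by fun_prop) _ _)]
  have hcr : c * t ^ (2 * q - 1) = 5 * r := by rw [hr]; ring
  linarith [hh.2]

/-- Corollary 1.4 of the paper. For `b > a ≥ 3` or `(a,b) = (2,3)` the curve
`γ_ε(t) = (t^{b/a}, t, 0)` is simultaneously `C¹`-rigid and not length-minimizing. -/
theorem gamma_C1rigid_and_not_minimizing (a b : ℕ)
    (hab : (3 ≤ a ∧ a < b) ∨ (a = 2 ∧ b = 3)) (ε : ℝ) (hε : 0 < ε) :
    -- (i) `γ_ε` is `C¹`-rigid
    (∃ δ : ℝ, 0 < δ ∧ ∀ η : HorizontalCurve a b ε,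
      η.x 0 = 0 → η.y 0 = 0 → η.z 0 = 0 →
      η.x ε = ε ^ ((b : ℝ) / a) → η.y ε = ε → η.z ε = 0 →
      (∀ t ∈ Icc (0:ℝ) ε, |η.x t - t ^ ((b : ℝ) / a)| < δ ∧ |η.y t - t| < δ ∧ |η.z t| < δ) →
      (∀ᵐ t ∂volume, t ∈ Icc (0:ℝ) ε →
        |η.d1 t - ((b : ℝ) / a) * t ^ ((b : ℝ) / a - 1)| < δ ∧ |η.d2 t - 1| < δ) →
      ∀ t ∈ Icc (0:ℝ) ε, (η.x t) ^ a = (η.y t) ^ b ∧ η.z t = 0) ∧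
    -- (ii) `γ_ε` is not length-minimizing
    (∃ τ : ℝ, 0 < τ ∧ ∃ η : HorizontalCurve a b τ,
      η.x 0 = 0 ∧ η.y 0 = 0 ∧ η.z 0 = 0 ∧
      η.x τ = ε ^ ((b : ℝ) / a) ∧ η.y τ = ε ∧ η.z τ = 0 ∧
      η.length < ∫ t in (0:ℝ)..ε,
        Real.sqrt (1 + ((b : ℝ) / a) ^ 2 * t ^ (2 * ((b : ℝ) / a) - 2))) := by
  have ha : 1 ≤ a := by omega
  have ha' : (0:ℝ) < a := by exact_mod_cast ha
  constructor
  · refine ⟨1, one_pos, fun η _ _ hz0 _ _ hzε _ hd => ?_⟩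
    refine η.eq_zero_of_d2_pos hε ?_ hz0 hzε
    filter_upwards [hd] with t ht hm
    linarith [(abs_lt.1 (ht hm).2).1]
  · have hq1 : (1:ℝ) < (b:ℝ) / a := by
      rw [one_lt_div ha']
      exact_mod_cast (by omega : a < b)
    have hexp : 6 * ((b:ℝ) / a) < 2 * b + 4 := by
      rcases hab with ⟨h3, -⟩ | ⟨rfl, rfl⟩
      · have h3' : (3:ℝ) ≤ a := by exact_mod_cast h3
        have : (b:ℝ) / a ≤ b / 3 := div_le_div_of_nonneg_left (by positivity) (by norm_num) h3'
        linarith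
      · norm_num
    obtain ⟨ℓ, ⟨τ, hτ, η, h0, h1, hl⟩, hlt⟩ :=
      exists_shorter_horizontallyJoined ha (div_mul_cancel₀ (b:ℝ) ha'.ne') hq1 hexp hε
    simp only [Prod.mk.injEq] at h0 h1
    obtain ⟨hx0, hy0, hz0⟩ := h0
    obtain ⟨hx1, hy1, hz1⟩ := h1
    refine ⟨τ, hτ.lt_of_ne ?_, η, hx0, hy0, hz0, hx1, hy1, hz1, hl ▸ hlt⟩
    rintro rfl
    exact hε.ne (hy0.symm.trans hy1)
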